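/- arXiv:1303.1239 — 2 statements merged into one kernel-verified Lean document; each statement's English description precedes it below -/
import Mathlib

section
/- Let S be a finite set, x an S-cube in an abelian category, and T ⊆ S a subset. If (1) x is degenerate along the k-direction for every k ∈ T (i.e., d_{U∪{k}}^{x,k} is an isomorphism for every U ⊆ S∖{k}), and (2) the restriction x|_{S∖T}^{∅} is admissible, then x is admissible. -/
open CategoryTheory CategoryTheory.Limits Opposite

attribute [local instance] CategoryTheory.Abelian.hasFiniteBiproducts

set_option linter.unusedSectionVars false

universe w v u

/-- An `ι`-cube in a category `𝒜`: a contravariant functor from the poset of finite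
subsets of `ι` (ordered by inclusion) to `𝒜`.  An `S`-cube (for `S : Finset ι`) is such a
functor, of which only the values on subsets of `S` are relevant. -/
abbrev Cube (𝒜 : Type u) [Category.{v} 𝒜] (ι : Type w) := (Finset ι)ᵒᵖ ⥤ 𝒜

namespace Cube

variable {𝒜 : Type u} [Category.{v} 𝒜] {ι : Type w} [DecidableEq ι]

/-- The vertex `x_T` of a cube `x` at a finite subset `T`. -/
def vtx (x : Cube 𝒜 ι) (T : Finset ι) : 𝒜 := x.obj (op T)

/-- The structure morphism `x_T ⟶ x_U` of a cube for `U ⊆ T`. -/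
def mapLE (x : Cube 𝒜 ι) {T U : Finset ι} (h : U ⊆ T) : x.vtx T ⟶ x.vtx U :=
  x.map (homOfLE h).op

lemma mapLE_refl (x : Cube 𝒜 ι) (T : Finset ι) (h : T ⊆ T) : x.mapLE h = 𝟙 (x.vtx T) := by
  show x.map (homOfLE h).op = _
  rw [show (homOfLE h).op = 𝟙 (op T) from rfl, x.map_id]; rfl

lemma mapLE_comp (x : Cube 𝒜 ι) {T U V : Finset ι} (h1 : U ⊆ T) (h2 : V ⊆ U) :
    x.mapLE h1 ≫ x.mapLE h2 = x.mapLE (h2.trans h1) := by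
  show x.map _ ≫ x.map _ = x.map _
  rw [← x.map_comp]
  rfl

/-- The `k`-direction boundary morphism `d^k_T : x_T ⟶ x_{T ∖ {k}}` of a cube. -/
def bd (x : Cube 𝒜 ι) (T : Finset ι) (k : ι) : x.vtx T ⟶ x.vtx (T.erase k) :=
  x.mapLE (Finset.erase_subset k T)

/-- The `k`-direction `0`-th homology `H⁰ₖ(x)` of a cube in an abelian category, an
`(S ∖ {k})`-cube: its vertex at `T` is the cokernel of the boundary morphism
`d^k_{T ∪ {k}} : x_{T ∪ {k}} ⟶ x_{(T ∪ {k}) ∖ {k}}`. -/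
noncomputable def H0 [Abelian 𝒜] (x : Cube 𝒜 ι) (k : ι) : Cube 𝒜 ι where
  obj T := cokernel (x.bd (insert k T.unop) k)
  map {T U} f :=
    cokernel.map _ _
      (x.mapLE (Finset.insert_subset_insert k (leOfHom f.unop)))
      (x.mapLE (Finset.erase_subset_erase k (Finset.insert_subset_insert k (leOfHom f.unop))))
      (by rw [bd, bd, mapLE_comp, mapLE_comp])
  map_id T := by
    apply coequalizer.hom_ext
    simp [cokernel.map]
    rw [mapLE_refl]
    simp
  map_comp {T U V} f g := by
    apply coequalizer.hom_ext
    simp [cokernel.map]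
    rw [← Category.assoc, mapLE_comp]

/-- Admissibility of an `S`-cube `x` in an abelian category, by recursion on `#S`:
`x` is admissible if all its boundary morphisms `d^k_T` (`k ∈ T ⊆ S`) are monomorphisms and
for every `k ∈ S` the `(S ∖ {k})`-cube `H⁰ₖ(x)` is admissible.  (For `S = ∅` the conditions
are vacuous, and for `#S = 1` this says exactly that the boundary morphism of `x` is a
monomorphism.) -/
def Admissible [Abelian 𝒜] (x : Cube 𝒜 ι) (S : Finset ι) : Prop :=
  (∀ T ⊆ S, ∀ k ∈ T, Mono (x.bd T k)) ∧
  ∀ k, (hk : k ∈ S) → Admissible (x.H0 k) (S.erase k)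
termination_by S.card
decreasing_by exact Finset.card_erase_lt_of_mem hk

/-- Iterated `0`-th homology:
`H0s x [i₁, …, i_r] = H⁰_{i₁}(H⁰_{i₂}(⋯(H⁰_{i_r}(x))⋯))`. -/
noncomputable def H0s [Abelian 𝒜] (x : Cube 𝒜 ι) : List ι → Cube 𝒜 ι
  | [] => x
  | k :: ks => (x.H0s ks).H0 k

/-- The restriction `x|_U^V` of a cube to `U` along `V` (for disjoint `U`, `V`): the
`U`-cube `T ↦ x_{T ∪ V}`.  (It is implemented as the cube `T ↦ x_{(T ∩ U) ∪ V}`, whose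
vertex at any subset `T ⊆ U` is exactly `x_{T ∪ V}`.) -/
def res (x : Cube 𝒜 ι) (U V : Finset ι) : Cube 𝒜 ι :=
  (Monotone.functor (f := fun T : Finset ι => (T ∩ U) ∪ V)
    (fun _ _ h => Finset.union_subset_union (Finset.inter_subset_inter h (subset_refl U))
      (subset_refl V))).op ⋙ x

end Cube

namespace Cube

variable {𝒜 : Type u} [Category.{v} 𝒜] {ι : Type w} [DecidableEq ι]

lemma isZero_coker [Abelian 𝒜] {A B : 𝒜} (f : A ⟶ B) (h : IsZero B) : IsZero (cokernel f) :=
  IsZero.of_epi (cokernel.π f) h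

lemma cokernel_map_square [Abelian 𝒜] {A B A₁ B₁ A₂ B₂ A₃ B₃ : 𝒜} (f : A ⟶ B) (f₁ : A₁ ⟶ B₁)
    (f₂ : A₂ ⟶ B₂) (f₃ : A₃ ⟶ B₃) (p₁ : A ⟶ A₁) (q₁ : B ⟶ B₁) (w₁ : f ≫ q₁ = p₁ ≫ f₁)
    (p₂ : A ⟶ A₂) (q₂ : B ⟶ B₂) (w₂ : f ≫ q₂ = p₂ ≫ f₂)
    (p₃ : A₁ ⟶ A₃) (q₃ : B₁ ⟶ B₃) (w₃ : f₁ ≫ q₃ = p₃ ≫ f₃)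
    (p₄ : A₂ ⟶ A₃) (q₄ : B₂ ⟶ B₃) (w₄ : f₂ ≫ q₄ = p₄ ≫ f₃) (h : q₁ ≫ q₃ = q₂ ≫ q₄) :
    cokernel.map f f₁ p₁ q₁ w₁ ≫ cokernel.map f₁ f₃ p₃ q₃ w₃ =
      cokernel.map f f₂ p₂ q₂ w₂ ≫ cokernel.map f₂ f₃ p₄ q₄ w₄ := by
  apply coequalizer.hom_ext
  simp [cokernel.map, reassoc_of% h]

def vapp {x y : Cube 𝒜 ι} (φ : x ⟶ y) (U : Finset ι) : x.vtx U ⟶ y.vtx U := φ.app (op U)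

lemma vapp_mapLE {x y : Cube 𝒜 ι} (φ : x ⟶ y) {U V : Finset ι} (h : V ⊆ U) :
    x.mapLE h ≫ vapp φ V = vapp φ U ≫ y.mapLE h := φ.naturality _

lemma isZero_admissible [Abelian 𝒜] (n : ℕ) : ∀ (x : Cube 𝒜 ι) (S : Finset ι), S.card = n →
    (∀ U ⊆ S, IsZero (x.vtx U)) → x.Admissible S := by
  induction n with
  | zero =>
    intro x S hS _
    obtain rfl := Finset.card_eq_zero.mp hS
    rw [Admissible]
    refine ⟨fun T hT k hk => absurd (hT hk) (Finset.notMem_empty k),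
      fun k hk => absurd hk (Finset.notMem_empty k)⟩
  | succ n ih =>
    intro x S hS hz
    rw [Admissible]
    refine ⟨fun T hT k hk => ⟨fun a b _ => (hz T hT).eq_of_tgt a b⟩, fun k hk => ?_⟩
    refine ih _ _ (by rw [Finset.card_erase_of_mem hk, hS]; rfl) fun U hU => ?_
    have h0 : IsZero (x.vtx ((insert k U).erase k)) := hz _ (by
      intro a ha
      simp only [Finset.mem_erase, Finset.mem_insert] at ha
      exact Finset.mem_of_mem_erase (hU (ha.2.resolve_left ha.1)))
    exact isZero_coker (x.bd (insert k U) k) h0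

lemma isIso_cokernel_map [Abelian 𝒜] {A B C D : 𝒜} (f : A ⟶ B) (g : C ⟶ D) (p : A ⟶ C)
    (q : B ⟶ D) (w : f ≫ q = p ≫ g) [IsIso p] [IsIso q] : IsIso (cokernel.map f g p q w) :=
  (cokernel.mapIso f g (asIso p) (asIso q) w).isIso_hom

noncomputable def H0map [Abelian 𝒜] {x y : Cube 𝒜 ι} (φ : x ⟶ y) (k : ι) : x.H0 k ⟶ y.H0 k where
  app U := cokernel.map (x.bd (insert k U.unop) k) (y.bd (insert k U.unop) k)
    (vapp φ _) (vapp φ _) (vapp_mapLE φ _)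
  naturality U V f := 
    cokernel_map_square _ _ _ _
      (x.mapLE (Finset.insert_subset_insert k (leOfHom f.unop))) _
      (by rw [bd, bd, mapLE_comp, mapLE_comp]) _ _ _ _ _ _
      (y.mapLE (Finset.insert_subset_insert k (leOfHom f.unop))) _
      (by rw [bd, bd, mapLE_comp, mapLE_comp]) (vapp_mapLE φ _)

lemma isIso_mapLE (x : Cube 𝒜 ι) (S T : Finset ι)
    (hdeg : ∀ k ∈ T, ∀ U ⊆ S.erase k, IsIso (x.bd (insert k U) k)) (n : ℕ) :
    ∀ (U V : Finset ι) (h : V ⊆ U), U ⊆ S → U \ V ⊆ T → (U \ V).card = n →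
      IsIso (x.mapLE h) := by
  induction n with
  | zero =>
    intro U V h hU hUV hc
    have : U = V := Finset.Subset.antisymm
      (Finset.sdiff_eq_empty_iff_subset.mp (Finset.card_eq_zero.mp hc)) h
    subst this
    rw [mapLE_refl]
    infer_instance
  | succ n ih =>
    intro U V h hU hUV hc
    obtain ⟨k, hk⟩ := Finset.card_pos.mp (by rw [hc]; exact Nat.succ_pos n)
    have hk' := Finset.mem_sdiff.mp hk
    have h1 : IsIso (x.bd U k) := by
      have := hdeg k (hUV hk) (U.erase k) (Finset.erase_subset_erase k hU)
      rwa [Finset.insert_erase hk'.1] at this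
    have hV : V ⊆ U.erase k := Finset.subset_erase.mpr ⟨h, hk'.2⟩
    have he : U.erase k \ V = (U \ V).erase k := Finset.erase_sdiff_comm U V k
    have h2 : IsIso (x.mapLE hV) := ih _ _ hV ((Finset.erase_subset k U).trans hU)
      (by rw [he]; exact (Finset.erase_subset _ _).trans hUV)
      (by rw [he, Finset.card_erase_of_mem hk, hc]; rfl)
    rw [← mapLE_comp x (Finset.erase_subset k U) hV]
    change IsIso (x.bd U k ≫ _)
    infer_instance

lemma admissible_aux [Abelian 𝒜] (n : ℕ) : ∀ (x y : Cube 𝒜 ι) (φ : x ⟶ y) (S T : Finset ι),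
    S.card = n → 
    (∀ (U V : Finset ι) (h : V ⊆ U), U ⊆ S → U \ V ⊆ T → IsIso (x.mapLE h)) →
    (∀ U ⊆ S \ T, IsIso (vapp φ U)) → y.Admissible (S \ T) → x.Admissible S := by
  induction n with
  | zero =>
    intro x y φ S T hS _ _ _
    obtain rfl := Finset.card_eq_zero.mp hS
    rw [Admissible]
    refine ⟨fun T hT k hk => absurd (hT hk) (Finset.notMem_empty k),
      fun k hk => absurd hk (Finset.notMem_empty k)⟩
  | succ n ih =>
    intro x y φ S T hS hx hφ hy
    rw [Admissible] at hy ⊢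
    refine ⟨fun U hU k hk => ?_, fun k hk => ?_⟩
    · by_cases hkT : k ∈ T
      · have : IsIso (x.bd U k) := hx U _ _ hU (by
          intro a ha
          simp only [Finset.mem_sdiff, Finset.mem_erase] at ha
          have : a = k := by tauto
          rwa [this])
        infer_instance
      · have hV : U \ T ⊆ S \ T := Finset.sdiff_subset_sdiff hU (Finset.Subset.refl T)
        have i1 : IsIso (x.mapLE (Finset.sdiff_subset : U \ T ⊆ U)) := hx _ _ _ hU (by
          intro a ha
          simp only [Finset.mem_sdiff] at ha
          tauto)
        have m1 : Mono (y.bd (U \ T) k) := hy.1 _ hV k (Finset.mem_sdiff.mpr ⟨hk, hkT⟩)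
        have i2 : IsIso (vapp φ (U \ T)) := hφ _ hV
        have e : x.bd (U \ T) k ≫ vapp φ ((U \ T).erase k) =
          vapp φ (U \ T) ≫ y.bd (U \ T) k := vapp_mapLE φ _
        have m2 : Mono (x.bd (U \ T) k ≫ vapp φ ((U \ T).erase k)) := by
          rw [e]; exact mono_comp _ _
        have m3 : Mono (x.bd (U \ T) k) := mono_of_mono _ (vapp φ ((U \ T).erase k))
        have e2 : x.bd U k ≫ x.mapLE (Finset.erase_subset_erase k Finset.sdiff_subset) =
            x.mapLE (Finset.sdiff_subset : U \ T ⊆ U) ≫ x.bd (U \ T) k := by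
          rw [bd, bd, mapLE_comp, mapLE_comp]
        have m4 : Mono (x.bd U k ≫
            x.mapLE (Finset.erase_subset_erase k (Finset.sdiff_subset : U \ T ⊆ U))) := by
          rw [e2]; exact mono_comp _ _
        exact mono_of_mono _ (x.mapLE (Finset.erase_subset_erase k (Finset.sdiff_subset : U \ T ⊆ U)))
    · have hins : ∀ U ⊆ S.erase k, insert k U ⊆ S := fun U hU =>
        Finset.insert_subset hk (hU.trans (Finset.erase_subset k S))
      have hc : (S.erase k).card = n := by rw [Finset.card_erase_of_mem hk, hS]; rfl
      by_cases hkT : k ∈ T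
      · refine isZero_admissible n _ _ hc fun U hU => ?_
        have : IsIso (x.bd (insert k U) k) := hx _ _ _ (hins U hU) (by
          intro a ha
          simp only [Finset.mem_sdiff, Finset.mem_erase] at ha
          have : a = k := by tauto
          rwa [this])
        exact isZero_cokernel_of_epi (x.bd (insert k U) k)
      · have hkR : k ∈ S \ T := Finset.mem_sdiff.mpr ⟨hk, hkT⟩
        have hE : S.erase k \ T = (S \ T).erase k := Finset.erase_sdiff_comm S T k
        refine ih (x.H0 k) (y.H0 k) (H0map φ k) _ T hc ?_ ?_ ?_
        · intro U V h hU hUV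
          have j1 : IsIso (x.mapLE (Finset.insert_subset_insert k h)) :=
            hx _ _ _ (hins U hU) (by
              intro a ha
              simp only [Finset.mem_sdiff, Finset.mem_insert] at ha
              exact hUV (Finset.mem_sdiff.mpr (by tauto)))
          have j2 : IsIso (x.mapLE (Finset.erase_subset_erase k
              (Finset.insert_subset_insert k h))) :=
            hx _ _ _ ((Finset.erase_subset _ _).trans (hins U hU)) (by
              intro a ha
              simp only [Finset.mem_sdiff, Finset.mem_insert, Finset.mem_erase] at ha
              exact hUV (Finset.mem_sdiff.mpr (by tauto)))
          exact isIso_cokernel_map (x.bd (insert k U) k) (x.bd (insert k V) k)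
            (x.mapLE (Finset.insert_subset_insert k h))
            (x.mapLE (Finset.erase_subset_erase k (Finset.insert_subset_insert k h)))
            (by rw [bd, bd, mapLE_comp, mapLE_comp])
        · intro U hU
          rw [hE] at hU
          have hi : insert k U ⊆ S \ T :=
            Finset.insert_subset hkR (hU.trans (Finset.erase_subset _ _))
          have j1 := hφ _ hi
          have j2 := hφ _ ((Finset.erase_subset k _).trans hi)
          exact isIso_cokernel_map (x.bd (insert k U) k) (y.bd (insert k U) k)
            (vapp φ _) (vapp φ _) (vapp_mapLE φ _)
        · rw [hE]
          exact hy.2 k hkR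

def toRes (x : Cube 𝒜 ι) (R : Finset ι) : x ⟶ x.res R ∅ where
  app U := x.map (homOfLE (by
    intro a ha
    simp only [Finset.mem_union, Finset.mem_inter, Finset.notMem_empty, or_false] at ha
    exact ha.1 : (U.unop ∩ R) ∪ ∅ ⊆ U.unop)).op
  naturality U V f := by
    exact (x.map_comp _ _).symm.trans
      ((congrArg x.map (Subsingleton.elim _ _)).trans (x.map_comp _ _))

end Cube

/-- Let `x` be an `S`-cube in an abelian category and `T ⊆ S`.  If `x` is
degenerate along the `k`-direction for every `k ∈ T` (all boundary morphisms
`d^k_{U ∪ {k}}`, `U ⊆ S ∖ {k}`, are isomorphisms) and the restriction `x|_{S∖T}^{∅}` is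
admissible, then `x` is admissible. -/
theorem admissible_of_degenerate_directions {𝒜 : Type u} [Category.{v} 𝒜] [Abelian 𝒜]
    {ι : Type w} [DecidableEq ι] (x : Cube 𝒜 ι) (S T : Finset ι) (hT : T ⊆ S)
    (hdeg : ∀ k ∈ T, ∀ U ⊆ S.erase k, IsIso (x.bd (insert k U) k))
    (hadm : (x.res (S \ T) ∅).Admissible (S \ T)) :
    x.Admissible S := by
  refine Cube.admissible_aux _ x _ (x.toRes (S \ T)) S T rfl
    (fun U V h hU hUV => Cube.isIso_mapLE x S T hdeg _ U V h hU hUV rfl) ?_ hadm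
  intro U hU
  refine Cube.isIso_mapLE x S ∅ (by simp) 0 U ((U ∩ (S \ T)) ∪ ∅) _
    (hU.trans Finset.sdiff_subset) ?_ ?_
  · rw [Finset.union_empty, Finset.inter_eq_left.mpr hU]; simp
  · rw [Finset.union_empty, Finset.inter_eq_left.mpr hU]; simp
end

section
/- Let A be a commutative noetherian ring with 1, let f_1,…,f_q be an A-sequence, and let n be an integer with q ≤ n < ∞. For any finitely generated A-module M of projective dimension ≤ n+1 whose support is contained in V((f_1,…,f_q)) (equivalently, each f_i acts nilpotently on M), there exist a finitely generated A-module N of projective dimension ≤ n whose support is contained in V((f_1,…,f_q)) and a surjective A-linear map N ↠ M. Moreover, if (f_1,…,f_q)·M = 0, then N can be chosen with (f_1,…,f_q)·N = 0. -/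
universe v u

/-- A list `f₁, …, f_q` of elements of a commutative ring `R` is an *`R`-regular sequence*
if no `fᵢ` is a unit and, for each `i`, `f_{i+1}` is a non-zero-divisor on
`R/(f₁, …, fᵢ)`. -/
def IsRegularSeq {R : Type*} [CommRing R] (fs : List R) : Prop :=
  (∀ f ∈ fs, ¬ IsUnit f) ∧
  ∀ i : Fin fs.length, ∀ x : R,
    fs.get i * x ∈ Ideal.span {y | y ∈ fs.take i.1} →
    x ∈ Ideal.span {y | y ∈ fs.take i.1}

/-- A list is an *`R`-sequence* if every permutation of it is an `R`-regular sequence. -/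
def IsRSeq {R : Type*} [CommRing R] (fs : List R) : Prop :=
  ∀ gs : List R, gs.Perm fs → IsRegularSeq gs

/-- `pdLE A n M` : the `A`-module `M` has projective dimension at most `n`. -/
def pdLE (A : Type u) [CommRing A] : ℕ → (M : Type v) → [AddCommGroup M] → [Module A M] → Prop
  | 0, M, _, _ => Module.Projective A M
  | n+1, M, _, _ => ∃ (P : Type v) (_ : AddCommGroup P) (_ : Module A P) (g : P →ₗ[A] M),
      Module.Projective A P ∧ Function.Surjective g ∧ pdLE A n (LinearMap.ker g)

open RingTheory.Sequence CategoryTheory in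
theorem aux_wr_ext {R : Type*} [CommRing R] (rs : List R) :
    ∀ {M₁ M₂ M₃ : Type u} [AddCommGroup M₁] [AddCommGroup M₂] [AddCommGroup M₃]
    [Module R M₁] [Module R M₂] [Module R M₃] (a : M₁ →ₗ[R] M₂) (b : M₂ →ₗ[R] M₃),
    Function.Injective a → Function.Exact a b → Function.Surjective b →
    IsWeaklyRegular M₁ rs → IsWeaklyRegular M₃ rs → IsWeaklyRegular M₂ rs := by
  induction rs with
  | nil => intros; exact IsWeaklyRegular.nil _ _
  | cons r rs ih =>
    intro M₁ M₂ M₃ _ _ _ _ _ _ a b ha hab hb h1 h3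
    rw [isWeaklyRegular_cons_iff] at h1 h3 ⊢
    refine ⟨isSMulRegular_of_range_eq_ker ha (LinearMap.exact_iff.mp hab).symm h1.1 h3.1, ?_⟩
    refine ih (QuotSMulTop.map r a) (QuotSMulTop.map r b) ?_
      (QuotSMulTop.map_exact r hab hb) (QuotSMulTop.map_surjective r hb) h1.2 h3.2
    have h0 : Function.Exact (0 : M₁ →ₗ[R] M₁) a := by
      rw [LinearMap.exact_iff, LinearMap.ker_eq_bot.mpr ha, LinearMap.range_zero]
    have := QuotSMulTop.map_first_exact_on_four_term_exact_of_isSMulRegular_last h0 hab h3.1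
    rw [LinearMap.exact_iff, map_zero, LinearMap.range_zero] at this
    exact LinearMap.ker_eq_bot.mp this

open RingTheory.Sequence in
theorem aux_wr_subsingleton {R : Type*} [CommRing R] (rs : List R) {M : Type u}
    [AddCommGroup M] [Module R M] [Subsingleton M] : IsWeaklyRegular M rs := by
  rw [isWeaklyRegular_iff_Fin]
  intro i x y _
  exact Subsingleton.elim _ _

open RingTheory.Sequence Pointwise in
theorem aux_wr_pow_head {R : Type*} [CommRing R] (r : R) (rs : List R) {M : Type u}
    [AddCommGroup M] [Module R M] (hr : IsSMulRegular M r)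
    (h : IsWeaklyRegular (QuotSMulTop r M) rs) (k : ℕ) :
    IsWeaklyRegular (QuotSMulTop (r ^ k) M) rs := by
  induction k with
  | zero =>
    have : Subsingleton (QuotSMulTop (r ^ 0) M) := by
      rw [Submodule.Quotient.subsingleton_iff]; simp
    exact aux_wr_subsingleton rs
  | succ k ih =>
    have h1 : (r ^ k • (⊤ : Submodule R M)) ≤
        (r ^ (k+1) • (⊤ : Submodule R M)).comap (LinearMap.lsmul R M r) := by
      intro x hx
      obtain ⟨y, -, rfl⟩ := (Submodule.mem_smul_pointwise_iff_exists _ _ _).mp hx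
      refine (Submodule.mem_smul_pointwise_iff_exists _ _ _).mpr ⟨y, trivial, ?_⟩
      rw [pow_succ', mul_smul]; rfl
    have h2 : (r ^ (k+1) • (⊤ : Submodule R M)) ≤
        (r • (⊤ : Submodule R M)).comap LinearMap.id := by
      intro x hx
      obtain ⟨y, -, rfl⟩ := (Submodule.mem_smul_pointwise_iff_exists _ _ _).mp hx
      refine (Submodule.mem_smul_pointwise_iff_exists _ _ _).mpr ⟨r ^ k • y, trivial, ?_⟩
      simp [pow_succ', mul_smul]
    refine aux_wr_ext rs (Submodule.mapQ _ _ _ h1) (Submodule.mapQ _ _ _ h2) ?_ ?_ ?_ ih h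
    · rw [injective_iff_map_eq_zero]
      intro x hx
      obtain ⟨x, rfl⟩ := Submodule.Quotient.mk_surjective _ x
      rw [Submodule.mapQ_apply, Submodule.Quotient.mk_eq_zero] at hx
      obtain ⟨y, -, hy⟩ := (Submodule.mem_smul_pointwise_iff_exists _ _ _).mp hx
      rw [Submodule.Quotient.mk_eq_zero]
      refine (Submodule.mem_smul_pointwise_iff_exists _ _ _).mpr ⟨y, trivial, hr ?_⟩
      simpa [pow_succ', mul_smul] using hy
    · intro x
      obtain ⟨x, rfl⟩ := Submodule.Quotient.mk_surjective _ x
      rw [Submodule.mapQ_apply, Submodule.Quotient.mk_eq_zero]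
      constructor
      · intro hx
        obtain ⟨y, -, hy⟩ := (Submodule.mem_smul_pointwise_iff_exists _ _ _).mp hx
        refine ⟨Submodule.Quotient.mk y, ?_⟩
        rw [Submodule.mapQ_apply]
        exact congrArg _ hy
      · rintro ⟨y, hy⟩
        obtain ⟨y, rfl⟩ := Submodule.Quotient.mk_surjective _ y
        rw [Submodule.mapQ_apply, Submodule.Quotient.eq] at hy
        have := h2 hy
        simp only [LinearMap.lsmul_apply, Submodule.mem_comap, LinearMap.id_apply] at this ⊢
        have h3 : r • y ∈ r • (⊤ : Submodule R M) :=
          (Submodule.mem_smul_pointwise_iff_exists _ _ _).mpr ⟨y, trivial, rfl⟩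
        exact (Submodule.sub_mem_iff_right _ h3).mp this
    · intro x
      obtain ⟨x, rfl⟩ := Submodule.Quotient.mk_surjective _ x
      exact ⟨Submodule.Quotient.mk x, rfl⟩

open RingTheory.Sequence in
theorem aux_wr_pow {R : Type*} [CommRing R] (k : ℕ) (rs : List R) :
    ∀ {M : Type u} [AddCommGroup M] [Module R M], IsWeaklyRegular M rs →
    IsWeaklyRegular M (rs.map (· ^ k)) := by
  induction rs with
  | nil => intros; exact IsWeaklyRegular.nil _ _
  | cons r rs ih =>
    intro M _ _ h
    rw [isWeaklyRegular_cons_iff] at h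
    rw [List.map_cons, isWeaklyRegular_cons_iff]
    exact ⟨h.1.pow k, aux_wr_pow_head r _ h.1 (ih h.2) k⟩

open RingTheory.Sequence in
theorem aux_wr_of {R : Type*} [CommRing R] (rs : List R) (h : IsRegularSeq rs) :
    IsWeaklyRegular R rs := by
  rw [isWeaklyRegular_iff_Fin]
  intro i
  rw [isSMulRegular_quotient_iff_mem_of_smul_mem]
  intro x hx
  rw [smul_eq_mul, Ideal.mul_top] at hx ⊢
  exact h.2 i x hx

open RingTheory.Sequence CategoryTheory in
theorem aux_pd {A : Type u} [CommRing A] (rs : List A) :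
    ∀ (k : ℕ) (M : Type u) [AddCommGroup M] [Module A M],
    IsWeaklyRegular M rs → HasProjectiveDimensionLT (ModuleCat.of A M) (k + 1) →
    HasProjectiveDimensionLT
      (ModuleCat.of A (M ⧸ Ideal.ofList rs • (⊤ : Submodule A M))) (k + rs.length + 1) := by
  induction rs with
  | nil =>
    intro k M _ _ _ h
    exact hasProjectiveDimensionLT_of_iso (Submodule.quotEquivOfEqBot
      (Ideal.ofList [] • (⊤ : Submodule A M)) (by simp)).symm.toModuleIso _
  | cons r rs ih =>
    intro k M _ _ hreg h
    rw [isWeaklyRegular_cons_iff] at hreg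
    have hS := IsSMulRegular.smulShortComplex_shortExact (M := ModuleCat.of A M) hreg.1
    have h3 : HasProjectiveDimensionLT (ModuleCat.of A (QuotSMulTop r M)) (k + 1 + 1) :=
      hS.hasProjectiveDimensionLT_X₃ (k + 1) h
        (hasProjectiveDimensionLT_of_ge (ModuleCat.of A M) (k + 1) (k + 2) (by lia))
    have h4 := ih (k + 1) (QuotSMulTop r M) hreg.2 h3
    have := hasProjectiveDimensionLT_of_iso
      (Submodule.quotOfListConsSMulTopEquivQuotSMulTopInner M r rs).symm.toModuleIso
      (k + 1 + rs.length + 1)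
    rw [List.length_cons, show k + (rs.length + 1) + 1 = k + 1 + rs.length + 1 by lia]
    exact this

open CategoryTheory in
theorem aux_pdLE {A : Type u} [CommRing A] (n : ℕ) :
    ∀ (M : Type u) [AddCommGroup M] [Module A M],
    HasProjectiveDimensionLT (ModuleCat.of A M) (n + 1) → pdLE A n M := by
  induction n with
  | zero =>
    intro M _ _ h
    rw [zero_add, ← projective_iff_hasProjectiveDimensionLT_one,
      ← IsProjective.iff_projective] at h
    exact h
  | succ n ih =>
    intro M _ _ h
    have hs : Function.Surjective (Finsupp.linearCombination A (id : M → M)) :=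
      Finsupp.linearCombination_id_surjective A M
    refine ⟨M →₀ A, inferInstance, inferInstance, Finsupp.linearCombination A id,
      inferInstance, hs, ih _ ?_⟩
    exact ((LinearMap.shortExact_shortComplexKer hs).hasProjectiveDimensionLT_X₃_iff n
      (inferInstanceAs (Projective (ModuleCat.of A (M →₀ A))))).mp h

open RingTheory.Sequence CategoryTheory in
theorem aux_main {A : Type u} [CommRing A]
    {q n : ℕ} (f : Fin q → A) (hf : IsRSeq (List.ofFn f)) (hqn : q ≤ n)
    (M : Type u) [AddCommGroup M] [Module A M] [Module.Finite A M] (k : ℕ)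
    (hk : ∀ i : Fin q, ∀ x : M, (f i) ^ k • x = 0) :
    ∃ (N : Type u) (_ : AddCommGroup N) (_ : Module A N) (g : N →ₗ[A] M),
        Module.Finite A N ∧ pdLE A n N ∧
        (∀ i : Fin q, ∀ x : N, (f i) ^ k • x = 0) ∧
        Function.Surjective g := by
  obtain ⟨r, g, hg⟩ := Module.Finite.exists_fin' A M
  set L := (List.ofFn f).map (· ^ k) with hL
  have hmem : ∀ i, f i ^ k ∈ Ideal.ofList L := fun i =>
    Ideal.subset_span (by simp [hL, List.mem_ofFn])
  have hLr : IsWeaklyRegular A L := aux_wr_pow k _ (aux_wr_of _ (hf _ (List.Perm.refl _)))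
  have hF : IsWeaklyRegular (Fin r → A) L :=
    ((TensorProduct.rid A (Fin r → A)).isWeaklyRegular_congr L).mp
      hLr.isWeaklyRegular_lTensor
  have hle : Ideal.ofList L • (⊤ : Submodule A (Fin r → A)) ≤ LinearMap.ker g := by
    rw [Submodule.smul_le]
    intro a ha x _
    rw [LinearMap.mem_ker, map_smul]
    have : Ideal.ofList L ≤ Module.annihilator A M := by
      refine Ideal.span_le.mpr ?_
      intro y hy
      obtain ⟨z, hz, rfl⟩ := List.mem_map.mp hy
      obtain ⟨i, rfl⟩ := (List.mem_ofFn' _ _).mp hz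
      exact Module.mem_annihilator.mpr (hk i)
    exact Module.mem_annihilator.mp (this ha) _
  refine ⟨(Fin r → A) ⧸ Ideal.ofList L • (⊤ : Submodule A (Fin r → A)), inferInstance,
    inferInstance, Submodule.liftQ _ g hle, inferInstance, aux_pdLE n _ ?_, ?_, ?_⟩
  · have h := aux_pd L 0 (Fin r → A) hF (inferInstanceAs
      (HasProjectiveDimensionLT (ModuleCat.of A (Fin r → A)) 1))
    exact hasProjectiveDimensionLT_of_ge _ (0 + L.length + 1) (n + 1) (by simp [hL]; exact hqn)
  · intro i x
    obtain ⟨x, rfl⟩ := Submodule.Quotient.mk_surjective _ x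
    rw [← Submodule.Quotient.mk_smul, Submodule.Quotient.mk_eq_zero]
    exact Submodule.smul_mem_smul (hmem i) trivial
  · intro y
    obtain ⟨x, rfl⟩ := hg y
    exact ⟨Submodule.Quotient.mk x, rfl⟩

/-- Let `A` be a commutative noetherian ring, `f₁, …, f_q` an
`A`-sequence and `q ≤ n`.  Every finitely generated `A`-module `M` of projective dimension
at most `n + 1` supported on `V((f₁, …, f_q))` (i.e. each `fᵢ` acts nilpotently on `M`)
admits a surjection from a finitely generated `A`-module `N` of projective dimension at
most `n` supported on `V((f₁, …, f_q))`; moreover if `(f₁, …, f_q) • M = 0` then `N` can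
be chosen with `(f₁, …, f_q) • N = 0`. -/
theorem exists_surjection_of_smaller_pd {A : Type u} [CommRing A] [IsNoetherianRing A]
    {q n : ℕ} (f : Fin q → A) (hf : IsRSeq (List.ofFn f)) (hqn : q ≤ n)
    (M : Type u) [AddCommGroup M] [Module A M] [Module.Finite A M]
    (hpd : pdLE A (n + 1) M)
    (hsupp : ∀ i : Fin q, ∃ m : ℕ, ∀ x : M, (f i) ^ m • x = 0) :
    (∃ (N : Type u) (_ : AddCommGroup N) (_ : Module A N) (g : N →ₗ[A] M),
        Module.Finite A N ∧ pdLE A n N ∧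
        (∀ i : Fin q, ∃ m : ℕ, ∀ x : N, (f i) ^ m • x = 0) ∧
        Function.Surjective g) ∧
    ((∀ i : Fin q, ∀ x : M, f i • x = 0) →
      ∃ (N : Type u) (_ : AddCommGroup N) (_ : Module A N) (g : N →ₗ[A] M),
        Module.Finite A N ∧ pdLE A n N ∧
        (∀ i : Fin q, ∀ x : N, f i • x = 0) ∧
        Function.Surjective g) := by
  constructor
  · choose m hm using hsupp
    obtain ⟨N, i1, i2, g, hN, hp, hs, hg⟩ := aux_main f hf hqn M (∑ i, m i) (fun i x => by
      obtain ⟨c, hc⟩ := Nat.exists_eq_add_of_le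
        (Finset.single_le_sum (fun j _ => Nat.zero_le (m j)) (Finset.mem_univ i))
      rw [hc, add_comm, pow_add, mul_smul, hm, smul_zero])
    exact ⟨N, i1, i2, g, hN, hp, fun i => ⟨_, hs i⟩, hg⟩
  · intro h
    obtain ⟨N, i1, i2, g, hN, hp, hs, hg⟩ := aux_main f hf hqn M 1 (fun i x => by
      rw [pow_one, h])
    exact ⟨N, i1, i2, g, hN, hp, fun i x => by simpa using hs i x, hg⟩
end
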